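/- arXiv:2412.19706 — 2 statements merged into one kernel-verified Lean document; each statement's English description precedes it below -/
import Mathlib

section
/- For every finite set S of points in the closed unit l₁-ball {x ∈ ℝ³ : ‖x‖₁ ≤ 1}, there exists a wake-up tree for S rooted at the origin, with edge lengths measured by the l₁-norm on ℝ³, whose makespan is at most 13. -/
/-- `IsWakeUpTree d p₀ S parent t` : `parent` encodes a rooted spanning tree on the node
node set `{p₀} ∪ S` (each non-root node has a parent among the nodes and reaches the root
by iterating `parent`), the root `p₀` has exactly one child (when there is a non-root
node), every non-root node has at most two children, and `t v` is the sum of the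
`d`-distances along the tree path from `p₀` to `v` (so the makespan of the tree is the
maximum of `t` over the nodes). -/
def IsWakeUpTree {X : Type*} (d : X → X → ℝ) (p₀ : X) (S : Finset X)
    (parent : X → X) (t : X → ℝ) : Prop :=
  t p₀ = 0 ∧
  (∀ p ∈ S, p ≠ p₀ →
      (parent p = p₀ ∨ parent p ∈ S) ∧
      t p = t (parent p) + d (parent p) p ∧
      ∃ n : ℕ, parent^[n] p = p₀) ∧
  -- the root has at most one child
  (∀ x ∈ S, x ≠ p₀ → parent x = p₀ →
      ∀ y ∈ S, y ≠ p₀ → parent y = p₀ → x = y) ∧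
  -- the root has a child as soon as there is a non-root node
  ((∃ p ∈ S, p ≠ p₀) → ∃ c ∈ S, c ≠ p₀ ∧ parent c = p₀) ∧
  -- every non-root node has at most two children
  (∀ q ∈ S, q ≠ p₀ → ∀ x ∈ S, ∀ y ∈ S, ∀ z ∈ S,
      x ≠ p₀ → y ≠ p₀ → z ≠ p₀ →
      parent x = q → parent y = q → parent z = q →
      x = y ∨ x = z ∨ y = z)

/-- The empty set has a (trivial) wake-up tree. -/
theorem isWakeUpTree_empty {X : Type*} (d : X → X → ℝ) (q : X) :
    IsWakeUpTree d q ∅ id (fun _ => 0) := by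
  simp [IsWakeUpTree]

/-- Two wake-up trees rooted at `c`, on disjoint sets, combine into a wake-up tree rooted at `q`
in which `c` is the only child of the root. -/
theorem IsWakeUpTree.glue {X : Type*} {d : X → X → ℝ} {q c : X} {T₁ T₂ : Finset X}
    [DecidableEq X] {par₁ par₂ : X → X} {t₁ t₂ : X → ℝ} {B : ℝ}
    (h₁ : IsWakeUpTree d c T₁ par₁ t₁) (h₂ : IsWakeUpTree d c T₂ par₂ t₂)
    (hdisj : Disjoint T₁ T₂) (hc₁ : c ∉ T₁) (hc₂ : c ∉ T₂) (hqc : q ≠ c)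
    (hq₁ : q ∉ T₁) (hq₂ : q ∉ T₂) (hB : 0 ≤ B)
    (hB₁ : ∀ p ∈ T₁, t₁ p ≤ B) (hB₂ : ∀ p ∈ T₂, t₂ p ≤ B) :
    ∃ (par : X → X) (t : X → ℝ), IsWakeUpTree d q (insert c (T₁ ∪ T₂)) par t ∧
      ∀ p ∈ insert c (T₁ ∪ T₂), t p ≤ d q c + B := by
  obtain ⟨root₁, step₁, single₁, -, binary₁⟩ := h₁
  obtain ⟨root₂, step₂, single₂, -, binary₂⟩ := h₂
  rw [Finset.disjoint_left] at hdisj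
  let par : X → X := fun x => if x ∈ T₁ then par₁ x else if x ∈ T₂ then par₂ x else q
  let t : X → ℝ := fun x => if x ∈ T₁ then d q c + t₁ x else if x ∈ T₂ then d q c + t₂ x
    else if x = c then d q c else 0
  have par_left : ∀ x ∈ T₁, par x = par₁ x := fun x hx => by simp [par, hx]
  have par_right : ∀ x ∈ T₂, par x = par₂ x := fun x hx => by
    simp [par, hx, show x ∉ T₁ from fun h => hdisj h hx]
  have par_c : par c = q := by simp [par, hc₁, hc₂]
  have t_left : ∀ x ∈ T₁, t x = d q c + t₁ x := fun x hx => by simp [t, hx]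
  have t_right : ∀ x ∈ T₂, t x = d q c + t₂ x := fun x hx => by
    simp [t, hx, show x ∉ T₁ from fun h => hdisj h hx]
  have t_c : t c = d q c := by simp [t, hc₁, hc₂]
  have t_q : t q = 0 := by simp [t, hq₁, hq₂, hqc]
  have reach_c : ∃ n : ℕ, par^[n] c = q := ⟨1, par_c⟩
  have reach : ∀ (T : Finset X) (f : X → X), (∀ x ∈ T, par x = f x) → c ∉ T →
      (∀ x ∈ T, f x = c ∨ f x ∈ T) → ∀ (n : ℕ), ∀ x ∈ T, f^[n] x = c →
      ∃ m : ℕ, par^[m] x = q := by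
    intro T f hf hcT hstay n
    induction n with
    | zero => intro x hx hxc; exact absurd (hxc ▸ hx) hcT
    | succ n ih =>
      intro x hx hxc
      have next : ∃ m : ℕ, par^[m] (par x) = q := by
        rw [hf x hx]
        rcases hstay x hx with h | h
        · rwa [h]
        · exact ih _ h hxc
      obtain ⟨m, hm⟩ := next
      exact ⟨m + 1, hm⟩
  have ne₁ : ∀ x ∈ T₁, x ≠ c := fun x hx h => hc₁ (h ▸ hx)
  have ne₂ : ∀ x ∈ T₂, x ≠ c := fun x hx h => hc₂ (h ▸ hx)
  have stay₁ : ∀ x ∈ T₁, par₁ x = c ∨ par₁ x ∈ T₁ := fun x hx => (step₁ x hx (ne₁ x hx)).1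
  have stay₂ : ∀ x ∈ T₂, par₂ x = c ∨ par₂ x ∈ T₂ := fun x hx => (step₂ x hx (ne₂ x hx)).1
  refine ⟨par, t, ⟨t_q, ?_, ?_, fun _ => ⟨c, by simp, hqc.symm, par_c⟩, ?_⟩, ?_⟩
  · intro p hp _
    simp only [Finset.mem_insert, Finset.mem_union] at hp
    rcases hp with rfl | hp | hp
    · exact ⟨.inl par_c, by rw [par_c, t_c, t_q, zero_add], reach_c⟩
    · obtain ⟨-, ht, n, hn⟩ := step₁ p hp (ne₁ p hp)
      refine ⟨?_, ?_, reach T₁ par₁ par_left hc₁ stay₁ n p hp hn⟩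
      · rw [par_left p hp]; rcases stay₁ p hp with h | h <;> simp [h]
      · rw [par_left p hp, t_left p hp, ht]
        rcases stay₁ p hp with h | h
        · rw [h, t_c, root₁]; ring
        · rw [t_left _ h]; ring
    · obtain ⟨-, ht, n, hn⟩ := step₂ p hp (ne₂ p hp)
      refine ⟨?_, ?_, reach T₂ par₂ par_right hc₂ stay₂ n p hp hn⟩
      · rw [par_right p hp]; rcases stay₂ p hp with h | h <;> simp [h]
      · rw [par_right p hp, t_right p hp, ht]
        rcases stay₂ p hp with h | h
        · rw [h, t_c, root₂]; ring
        · rw [t_right _ h]; ring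
  · have root_child : ∀ x ∈ insert c (T₁ ∪ T₂), par x = q → x = c := by
      intro x hx hxq
      simp only [Finset.mem_insert, Finset.mem_union] at hx
      rcases hx with rfl | hx | hx
      · rfl
      · rw [par_left x hx] at hxq
        rcases stay₁ x hx with h | h <;> rw [hxq] at h
        exacts [absurd h hqc, absurd h hq₁]
      · rw [par_right x hx] at hxq
        rcases stay₂ x hx with h | h <;> rw [hxq] at h
        exacts [absurd h hqc, absurd h hq₂]
    intro x hx _ hxq y hy _ hyq
    rw [root_child x hx hxq, root_child y hy hyq]
  · intro r hr hrq x hx y hy z hz _ _ _ hxr hyr hzr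
    have children : ∀ x ∈ insert c (T₁ ∪ T₂), par x = r →
        (x ∈ T₁ ∧ par₁ x = r) ∨ (x ∈ T₂ ∧ par₂ x = r) := by
      intro x hx hxr
      simp only [Finset.mem_insert, Finset.mem_union] at hx
      rcases hx with rfl | hx | hx
      · exact absurd (hxr.symm.trans par_c) hrq
      · exact .inl ⟨hx, par_left x hx ▸ hxr⟩
      · exact .inr ⟨hx, par_right x hx ▸ hxr⟩
    have hx' := children x hx hxr
    have hy' := children y hy hyr
    have hz' := children z hz hzr
    simp only [Finset.mem_insert, Finset.mem_union] at hr
    rcases hr with rfl | hr | hr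
    · have unique₁ : ∀ {x y}, x ∈ T₁ ∧ par₁ x = r → y ∈ T₁ ∧ par₁ y = r → x = y :=
        fun hx hy => single₁ _ hx.1 (ne₁ _ hx.1) hx.2 _ hy.1 (ne₁ _ hy.1) hy.2
      have unique₂ : ∀ {x y}, x ∈ T₂ ∧ par₂ x = r → y ∈ T₂ ∧ par₂ y = r → x = y :=
        fun hx hy => single₂ _ hx.1 (ne₂ _ hx.1) hx.2 _ hy.1 (ne₂ _ hy.1) hy.2
      rcases hx' with hx' | hx' <;> rcases hy' with hy' | hy'
      · exact .inl (unique₁ hx' hy')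
      · exact .inr (hz'.imp (unique₁ hx') (unique₂ hy'))
      · exact .inr (hz'.symm.imp (unique₂ hx') (unique₁ hy'))
      · exact .inl (unique₂ hx' hy')
    · have notMem₂ : ∀ x, ¬ (x ∈ T₂ ∧ par₂ x = r) := by
        rintro x ⟨hx, rfl⟩
        exact (stay₂ x hx).elim (ne₁ _ hr) (hdisj hr)
      obtain ⟨hx₁, hxr'⟩ := hx'.resolve_right (notMem₂ x)
      obtain ⟨hy₁, hyr'⟩ := hy'.resolve_right (notMem₂ y)
      obtain ⟨hz₁, hzr'⟩ := hz'.resolve_right (notMem₂ z)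
      exact binary₁ r hr (ne₁ r hr) x hx₁ y hy₁ z hz₁ (ne₁ x hx₁) (ne₁ y hy₁) (ne₁ z hz₁)
        hxr' hyr' hzr'
    · have notMem₁ : ∀ x, ¬ (x ∈ T₁ ∧ par₁ x = r) := by
        rintro x ⟨hx, rfl⟩
        exact (stay₁ x hx).elim (ne₂ _ hr) fun h => hdisj h hr
      obtain ⟨hx₂, hxr'⟩ := hx'.resolve_left (notMem₁ x)
      obtain ⟨hy₂, hyr'⟩ := hy'.resolve_left (notMem₁ y)
      obtain ⟨hz₂, hzr'⟩ := hz'.resolve_left (notMem₁ z)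
      exact binary₂ r hr (ne₂ r hr) x hx₂ y hy₂ z hz₂ (ne₂ x hx₂) (ne₂ y hy₂) (ne₂ z hz₂)
        hxr' hyr' hzr'
  · intro p hp
    simp only [Finset.mem_insert, Finset.mem_union] at hp
    rcases hp with rfl | hp | hp
    · rw [t_c]; linarith
    · rw [t_left p hp]; linarith [hB₁ p hp]
    · rw [t_right p hp]; linarith [hB₂ p hp]

/-- Sweep strategy. The points of `T` lie in the half-space `x q ≤ x ≤ 1` and in the slab
`a ≤ u ≤ a + w`, `b ≤ v ≤ b + h`, where `d` is bounded by the progress made along `x` plus the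
larger of the two variations of `u` and `v`. Waking up the points by increasing `x`, and halving
the longer side of the slab each time a robot is awakened, costs at most `2 * (w + h)` in
the transverse directions after the first move. -/
theorem exists_isWakeUpTree_sweep {X : Type*} [DecidableEq X] {d : X → X → ℝ} {x : X → ℝ}
    (T : Finset X) (q : X) (u v : X → ℝ) (a b w h D : ℝ)
    (hd : ∀ p r D, x p ≤ x r → |u p - u r| ≤ D → |v p - v r| ≤ D → d p r ≤ x r - x p + D)
    (hq : q ∉ T) (hw : 0 ≤ w) (hh : 0 ≤ h)
    (hx : ∀ p ∈ T, x q ≤ x p ∧ x p ≤ 1)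
    (hu : ∀ p ∈ T, a ≤ u p ∧ u p ≤ a + w) (hv : ∀ p ∈ T, b ≤ v p ∧ v p ≤ b + h)
    (hDu : ∀ p ∈ T, |u q - u p| ≤ D) (hDv : ∀ p ∈ T, |v q - v p| ≤ D) :
    ∃ (par : X → X) (t : X → ℝ), IsWakeUpTree d q T par t ∧
      ∀ p ∈ T, t p ≤ D + 2 * (w + h) + (1 - x q) := by
  induction T using Finset.strongInduction generalizing q u v a b w h D with
  | H T ih =>
  wlog hwh : h ≤ w generalizing u v a b w h
  · rw [add_comm w h]
    exact this v u b a h w (fun p r D h₁ h₂ h₃ => hd p r D h₁ h₃ h₂) hh hw hv hu hDv hDu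
      (le_of_not_ge hwh)
  rcases T.eq_empty_or_nonempty with rfl | hT
  · exact ⟨_, _, isWakeUpTree_empty d q, by simp⟩
  obtain ⟨c, hcT, hcmin⟩ := T.exists_min_image x hT
  have sub : ∀ (s : Finset X) (a' : ℝ), s ⊆ T.erase c →
      (∀ p ∈ s, a' ≤ u p ∧ u p ≤ a' + w / 2) →
      ∃ (par : X → X) (t : X → ℝ), IsWakeUpTree d c s par t ∧
        ∀ p ∈ s, t p ≤ w + 2 * (w / 2 + h) + (1 - x c) := by
    intro s a' hs hsu
    have hsT : ∀ p ∈ s, p ∈ T := fun p hp => Finset.mem_of_mem_erase (hs hp)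
    refine ih s (hs.trans_ssubset (Finset.erase_ssubset hcT)) c u v a' b (w / 2) h w hd
      (fun hc => Finset.notMem_erase c T (hs hc)) (by linarith) hh
      (fun p hp => ⟨hcmin p (hsT p hp), (hx p (hsT p hp)).2⟩) hsu
      (fun p hp => hv p (hsT p hp)) (fun p hp => ?_) (fun p hp => ?_)
    · have h₁ := hu p (hsT p hp)
      have h₂ := hu c hcT
      rw [abs_le]; constructor <;> linarith
    · have h₁ := hv p (hsT p hp)
      have h₂ := hv c hcT
      rw [abs_le]; constructor <;> linarith
  set T₁ := (T.erase c).filter (fun p => u p ≤ a + w / 2) with hT₁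
  set T₂ := (T.erase c).filter (fun p => ¬ u p ≤ a + w / 2) with hT₂
  have hsub₁ : T₁ ⊆ T.erase c := Finset.filter_subset _ _
  have hsub₂ : T₂ ⊆ T.erase c := Finset.filter_subset _ _
  obtain ⟨par₁, t₁, tree₁, bound₁⟩ := sub T₁ a hsub₁ fun p hp =>
    ⟨(hu p (Finset.mem_of_mem_erase (hsub₁ hp))).1, (Finset.mem_filter.1 hp).2⟩
  obtain ⟨par₂, t₂, tree₂, bound₂⟩ := sub T₂ (a + w / 2) hsub₂ fun p hp =>
    ⟨le_of_not_ge (Finset.mem_filter.1 hp).2,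
      by linarith [(hu p (Finset.mem_of_mem_erase (hsub₂ hp))).2]⟩
  have hxc := hx c hcT
  obtain ⟨par, t, tree, bound⟩ := tree₁.glue (q := q) tree₂
    (Finset.disjoint_filter_filter_not _ _ _)
    (fun hc => Finset.notMem_erase c T (hsub₁ hc)) (fun hc => Finset.notMem_erase c T (hsub₂ hc))
    (fun hqc => hq (hqc ▸ hcT)) (fun hq' => hq (Finset.mem_of_mem_erase (hsub₁ hq')))
    (fun hq' => hq (Finset.mem_of_mem_erase (hsub₂ hq'))) (by linarith) bound₁ bound₂
  rw [hT₁, hT₂, Finset.filter_union_filter_not_eq, Finset.insert_erase hcT] at tree bound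
  exact ⟨par, t, tree, fun p hp => by
    linarith [bound p hp, hd q c D hxc.1 (hDu c hcT) (hDv c hcT)]⟩

/-- The root may be removed from the set of points to be awakened. -/
theorem IsWakeUpTree.of_erase {X : Type*} [DecidableEq X] {d : X → X → ℝ} {q : X} {S : Finset X}
    {par : X → X} {t : X → ℝ} (h : IsWakeUpTree d q (S.erase q) par t) :
    IsWakeUpTree d q S par t := by
  obtain ⟨root, step, single, child, binary⟩ := h
  refine ⟨root, fun p hp hpq => ?_, fun x hx hxq => ?_, ?_, ?_⟩
  · obtain ⟨h₁, h₂⟩ := step p (Finset.mem_erase.2 ⟨hpq, hp⟩) hpq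
    exact ⟨h₁.imp_right Finset.mem_of_mem_erase, h₂⟩
  · intro hxp y hy hyq
    exact single x (Finset.mem_erase.2 ⟨hxq, hx⟩) hxq hxp y (Finset.mem_erase.2 ⟨hyq, hy⟩) hyq
  · rintro ⟨p, hp, hpq⟩
    obtain ⟨c, hc, hcq⟩ := child ⟨p, Finset.mem_erase.2 ⟨hpq, hp⟩, hpq⟩
    exact ⟨c, Finset.mem_of_mem_erase hc, hcq⟩
  · intro r hr hrq x hx y hy z hz hxq hyq hzq
    exact binary r (Finset.mem_erase.2 ⟨hrq, hr⟩) hrq x (Finset.mem_erase.2 ⟨hxq, hx⟩)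
      y (Finset.mem_erase.2 ⟨hyq, hy⟩) z (Finset.mem_erase.2 ⟨hzq, hz⟩) hxq hyq hzq

/-- In the `l₁`-norm, the last two coordinates contribute `max |Δ(y + z)| |Δ(y - z)|`. -/
theorem l1Dist_le_of_abs_sub_le (p r : Fin 3 → ℝ) (D : ℝ) (hx : p 0 ≤ r 0)
    (hu : |(p 1 + p 2) - (r 1 + r 2)| ≤ D) (hv : |(p 1 - p 2) - (r 1 - r 2)| ≤ D) :
    ∑ i, |p i - r i| ≤ r 0 - p 0 + D := by
  rw [abs_le] at hu hv
  rw [Fin.sum_univ_three, abs_sub_comm (p 0), abs_of_nonneg (sub_nonneg.2 hx)]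
  rcases abs_cases (p 1 - r 1) with h₁ | h₁ <;> rcases abs_cases (p 2 - r 2) with h₂ | h₂ <;>
    linarith

/-- any finite set of points in the closed unit `l₁`-ball of `ℝ³` admits a
wake-up tree rooted at the origin, with `l₁`-norm edge lengths, of makespan at most `13`. -/
theorem freezeTag_l1Ball_R3_makespan_le (S : Finset (Fin 3 → ℝ))
    (hS : ∀ p ∈ S, ∑ i, |p i| ≤ 1) :
    ∃ (parent : (Fin 3 → ℝ) → (Fin 3 → ℝ)) (t : (Fin 3 → ℝ) → ℝ),
      IsWakeUpTree (fun u v => ∑ i, |u i - v i|) (0 : Fin 3 → ℝ) S parent t ∧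
      ∀ p ∈ S, t p ≤ 13 := by
  suffices H : ∃ (parent : (Fin 3 → ℝ) → (Fin 3 → ℝ)) (t : (Fin 3 → ℝ) → ℝ),
      IsWakeUpTree (fun u v => ∑ i, |u i - v i|) (0 : Fin 3 → ℝ) (S.erase 0) parent t ∧
      ∀ p ∈ S.erase 0, t p ≤ 13 by
    obtain ⟨par, t, tree, bound⟩ := H
    refine ⟨par, t, tree.of_erase, fun p hp => ?_⟩
    by_cases hp0 : p = 0
    · rw [hp0, tree.1]; norm_num
    · exact bound p (Finset.mem_erase.2 ⟨hp0, hp⟩)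
  rcases (S.erase 0).eq_empty_or_nonempty with hS0 | hS0
  · rw [hS0]
    exact ⟨_, _, isWakeUpTree_empty _ _, by simp⟩
  obtain ⟨c, hc, hcmin⟩ := (S.erase 0).exists_min_image (fun p => p 0) hS0
  have bounds : ∀ p ∈ S.erase 0, |p 0| ≤ 1 ∧ |p 1 + p 2| ≤ 1 ∧ |p 1 - p 2| ≤ 1 := by
    intro p hp
    have h := hS p (Finset.mem_of_mem_erase hp)
    rw [Fin.sum_univ_three] at h
    have := abs_nonneg (p 0)
    have := abs_add_le (p 1) (p 2)
    have := abs_sub (p 1) (p 2)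
    have := abs_nonneg (p 1)
    have := abs_nonneg (p 2)
    refine ⟨?_, ?_, ?_⟩ <;> linarith
  simp only [abs_le] at bounds
  have hbc := bounds c hc
  have mem : ∀ p ∈ (S.erase 0).erase c, p ∈ S.erase 0 := fun p => Finset.mem_of_mem_erase
  obtain ⟨par₁, t₁, tree₁, bound₁⟩ := exists_isWakeUpTree_sweep
    (d := fun u v => ∑ i, |u i - v i|) (x := fun p => p 0) ((S.erase 0).erase c) c
    (fun p => p 1 + p 2) (fun p => p 1 - p 2) (-1) (-1) 2 2 2 l1Dist_le_of_abs_sub_le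
    (Finset.notMem_erase _ _) zero_le_two zero_le_two
    (fun p hp => ⟨hcmin p (mem p hp), (bounds p (mem p hp)).1.2⟩)
    (fun p hp => by have := bounds p (mem p hp); constructor <;> linarith)
    (fun p hp => by have := bounds p (mem p hp); constructor <;> linarith)
    (fun p hp => by have := bounds p (mem p hp); rw [abs_le]; constructor <;> linarith)
    (fun p hp => by have := bounds p (mem p hp); rw [abs_le]; constructor <;> linarith)
  obtain ⟨par, t, tree, bound⟩ := tree₁.glue (q := 0) (B := 12)
    (isWakeUpTree_empty _ c) (Finset.disjoint_empty_right _) (Finset.notMem_erase _ _)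
    (Finset.notMem_empty _) (Finset.ne_of_mem_erase hc).symm
    (fun h => Finset.notMem_erase 0 S (mem 0 h)) (Finset.notMem_empty _) (by norm_num)
    (fun p hp => by linarith [bound₁ p hp]) (by simp)
  rw [Finset.union_empty, Finset.insert_erase hc] at tree bound
  refine ⟨par, t, tree, fun p hp => ?_⟩
  have first := hS c (Finset.mem_of_mem_erase hc)
  have := bound p hp
  simp only [Pi.zero_apply, zero_sub, abs_neg] at this
  linarith
end

section
/- Let S be the set of seven points on the unit circle in ℝ² with polar angles (in degrees) 31.52, 101.98, 148.90, 195.69, 225.69, 271.63 and 327.87, i.e. the points (cos θ, sin θ) for these angles θ. Then every wake-up tree for S rooted at the origin, with edge lengths measured by the Euclidean norm on ℝ², has makespan at least 3.49. In particular, the optimal makespan of this instance exceeds 3.431, the optimal makespan for seven points equally spaced on the unit circle. -/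
open scoped Classical

/-- The point of `ℝ²` (with the Euclidean norm) with coordinates `(a, b)`. -/
noncomputable def pt2 (a b : ℝ) : EuclideanSpace ℝ (Fin 2) :=
  (WithLp.equiv 2 (Fin 2 → ℝ)).symm ![a, b]

/-- The point of the unit circle with polar angle of `θ` degrees. -/
noncomputable def unitCirclePtDeg (θ : ℝ) : EuclideanSpace ℝ (Fin 2) :=
  pt2 (Real.cos (θ * Real.pi / 180)) (Real.sin (θ * Real.pi / 180))

/-- The seven-point instance with polar angles
`31.52°, 101.98°, 148.90°, 195.69°, 225.69°, 271.63°, 327.87°`. -/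
noncomputable def sevenPointInstance : Finset (EuclideanSpace ℝ (Fin 2)) :=
  {unitCirclePtDeg 31.52, unitCirclePtDeg 101.98, unitCirclePtDeg 148.90,
    unitCirclePtDeg 195.69, unitCirclePtDeg 225.69, unitCirclePtDeg 271.63,
    unitCirclePtDeg 327.87}

lemma le_of_hasDerivAt_le {f g f' g' : ℝ → ℝ} (hf : ∀ x, HasDerivAt f (f' x) x)
    (hg : ∀ x, HasDerivAt g (g' x) x) (h0 : f 0 ≤ g 0) (h : ∀ x, 0 ≤ x → f' x ≤ g' x)
    {x : ℝ} (hx : 0 ≤ x) : f x ≤ g x :=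
  image_le_of_deriv_right_le_deriv_boundary (a := 0) (b := x)
    (fun y _ => (hf y).continuousAt.continuousWithinAt) (fun y _ => (hf y).hasDerivWithinAt)
    h0 (fun y _ => (hg y).continuousAt.continuousWithinAt)
    (fun y _ => (hg y).hasDerivWithinAt) (fun y hy => h y hy.1) ⟨hx, le_rfl⟩

lemma cos_le_taylor_four {x : ℝ} (hx : 0 ≤ x) : Real.cos x ≤ 1 - x ^ 2 / 2 + x ^ 4 / 24 := by
  refine le_of_hasDerivAt_le (f := Real.cos) (g := fun x => 1 - x ^ 2 / 2 + x ^ 4 / 24)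
    (g' := fun x => -(x - x ^ 3 / 6)) Real.hasDerivAt_cos (fun y => ?_) (by simp)
    (fun y hy => neg_le_neg (Real.sin_ge_sub_cube hy)) hx
  refine HasDerivAt.congr_deriv ((((hasDerivAt_pow 2 y).div_const 2).const_sub 1).fun_add
    ((hasDerivAt_pow 4 y).div_const 24)) ?_
  norm_num
  ring

lemma sin_le_taylor_five {x : ℝ} (hx : 0 ≤ x) :
    Real.sin x ≤ x - x ^ 3 / 6 + x ^ 5 / 120 := by
  refine le_of_hasDerivAt_le (f := Real.sin) (g := fun x => x - x ^ 3 / 6 + x ^ 5 / 120)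
    (g' := fun x => 1 - x ^ 2 / 2 + x ^ 4 / 24) Real.hasDerivAt_sin (fun y => ?_) (by simp)
    (fun y hy => cos_le_taylor_four hy) hx
  refine HasDerivAt.congr_deriv
    (((hasDerivAt_id y).fun_sub ((hasDerivAt_pow 3 y).div_const 6)).fun_add
    ((hasDerivAt_pow 5 y).div_const 120)) ?_
  norm_num
  ring

lemma taylor_six_le_cos {x : ℝ} (hx : 0 ≤ x) :
    1 - x ^ 2 / 2 + x ^ 4 / 24 - x ^ 6 / 720 ≤ Real.cos x := by
  refine le_of_hasDerivAt_le (g := Real.cos)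
    (f := fun x => 1 - x ^ 2 / 2 + x ^ 4 / 24 - x ^ 6 / 720)
    (f' := fun x => -(x - x ^ 3 / 6 + x ^ 5 / 120)) (fun y => ?_) Real.hasDerivAt_cos (by simp)
    (fun y hy => neg_le_neg (sin_le_taylor_five hy)) hx
  refine HasDerivAt.congr_deriv (((((hasDerivAt_pow 2 y).div_const 2).const_sub 1).fun_add
    ((hasDerivAt_pow 4 y).div_const 24)).fun_sub ((hasDerivAt_pow 6 y).div_const 720)) ?_
  norm_num
  ring

lemma taylor_seven_le_sin {x : ℝ} (hx : 0 ≤ x) :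
    x - x ^ 3 / 6 + x ^ 5 / 120 - x ^ 7 / 5040 ≤ Real.sin x := by
  refine le_of_hasDerivAt_le (g := Real.sin)
    (f := fun x => x - x ^ 3 / 6 + x ^ 5 / 120 - x ^ 7 / 5040)
    (f' := fun x => 1 - x ^ 2 / 2 + x ^ 4 / 24 - x ^ 6 / 720) (fun y => ?_)
    Real.hasDerivAt_sin (by simp) (fun y hy => taylor_six_le_cos hy) hx
  refine HasDerivAt.congr_deriv
    ((((hasDerivAt_id y).fun_sub ((hasDerivAt_pow 3 y).div_const 6)).fun_add
    ((hasDerivAt_pow 5 y).div_const 120)).fun_sub ((hasDerivAt_pow 7 y).div_const 5040)) ?_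
  norm_num
  ring

lemma norm_unitCirclePtDeg (θ : ℝ) : ‖unitCirclePtDeg θ‖ = 1 := by
  simp [unitCirclePtDeg, pt2, EuclideanSpace.norm_eq]

lemma unitCirclePtDeg_ne_zero (θ : ℝ) : unitCirclePtDeg θ ≠ 0 := by
  rw [← norm_ne_zero_iff, norm_unitCirclePtDeg]
  exact one_ne_zero

lemma dist_unitCirclePtDeg (a b : ℝ) :
    dist (unitCirclePtDeg a) (unitCirclePtDeg b) = 2 * |Real.sin ((b - a) * Real.pi / 360)| := by
  have hb : b * Real.pi / 180 = a * Real.pi / 180 + 2 * ((b - a) * Real.pi / 360) := by ring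
  rw [EuclideanSpace.dist_eq, ← Real.sqrt_sq_eq_abs, ← Real.sqrt_sq (zero_le_two (α := ℝ)),
    ← Real.sqrt_mul (sq_nonneg 2)]
  congr 1
  simp only [unitCirclePtDeg, pt2, Fin.sum_univ_two, Real.dist_eq, sq_abs, hb]
  simp only [WithLp.equiv_symm_apply, Matrix.cons_val_zero, Matrix.cons_val_one]
  generalize a * Real.pi / 180 = u
  generalize (b - a) * Real.pi / 360 = v
  rw [Real.cos_add, Real.sin_add, Real.cos_two_mul, Real.sin_two_mul]
  have hu := Real.sin_sq_add_cos_sq u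
  have hv := Real.sin_sq_add_cos_sq v
  linear_combination ((2 * Real.cos v ^ 2 - 2) ^ 2 + 4 * Real.sin v ^ 2 * Real.cos v ^ 2) * hu +
    4 * (Real.cos v ^ 2 - 1) * hv

/-- A lower bound for the chord between two points of the unit circle whose angular distance,
measured along one of the two arcs, is `δ` degrees. -/
lemma le_dist_unitCirclePtDeg {a b δ D : ℝ} (hδ : 0 ≤ δ) (hδ' : δ ≤ 180)
    (hab : b - a = δ ∨ b - a = 360 - δ)
    (hD : D ≤ 2 * (3.1415 * δ / 360 - (3.1415 * δ / 360) ^ 3 / 6 + (3.1415 * δ / 360) ^ 5 / 120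
      - (3.1415 * δ / 360) ^ 7 / 5040)) :
    D ≤ dist (unitCirclePtDeg a) (unitCirclePtDeg b) := by
  have hsin : Real.sin ((b - a) * Real.pi / 360) = Real.sin (δ * Real.pi / 360) := by
    rcases hab with h | h
    · rw [h]
    · rw [h, ← Real.sin_pi_sub]
      congr 1
      ring
  rw [dist_unitCirclePtDeg, hsin]
  have hpi := Real.pi_gt_d4
  have hmono : Real.sin (3.1415 * δ / 360) ≤ Real.sin (δ * Real.pi / 360) :=
    Real.sin_le_sin_of_le_of_le_pi_div_two (by linarith) (by nlinarith)
      (by nlinarith)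
  have htaylor := taylor_seven_le_sin (x := 3.1415 * δ / 360) (by positivity)
  linarith [le_abs_self (Real.sin (δ * Real.pi / 360))]

/-- The polar angles, in degrees, of the seven points of the instance. -/
noncomputable def instanceAngle : Fin 7 → ℝ :=
  ![31.52, 101.98, 148.90, 195.69, 225.69, 271.63, 327.87]

lemma mem_sevenPointInstance {p : EuclideanSpace ℝ (Fin 2)} :
    p ∈ sevenPointInstance ↔ ∃ i, unitCirclePtDeg (instanceAngle i) = p := by
  simp [sevenPointInstance, instanceAngle, Fin.exists_fin_succ, eq_comm]

/-- Lower bounds, in hundredths, for the distances between the points of the instance. -/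
def chordBound : Fin 7 → Fin 7 → ℕ :=
  ![![0, 115, 170, 198, 198, 173, 105],
    ![115, 0, 79, 145, 176, 199, 184],
    ![170, 79, 0, 79, 124, 175, 199],
    ![198, 145, 79, 0, 51, 123, 182],
    ![198, 176, 124, 51, 0, 78, 155],
    ![173, 199, 175, 123, 78, 0, 94],
    ![105, 184, 199, 182, 155, 94, 0]]

lemma chordBound_symm (i j : Fin 7) : chordBound i j = chordBound j i := by
  decide +revert

lemma chordBound_pos {i j : Fin 7} (hij : i ≠ j) : 0 < chordBound i j := by
  decide +revert

lemma chordBound_le_dist_of_lt {i j : Fin 7} (hij : i < j) :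
    (chordBound i j : ℝ) ≤
      100 * dist (unitCirclePtDeg (instanceAngle i)) (unitCirclePtDeg (instanceAngle j)) := by
  suffices (chordBound i j : ℝ) / 100 ≤
      dist (unitCirclePtDeg (instanceAngle i)) (unitCirclePtDeg (instanceAngle j)) by linarith
  by_cases h : instanceAngle j - instanceAngle i ≤ 180
  · refine le_dist_unitCirclePtDeg ?_ h (Or.inl rfl) ?_
    all_goals
      revert h hij
      fin_cases i <;> fin_cases j <;> norm_num [instanceAngle, chordBound]
  · refine le_dist_unitCirclePtDeg (δ := 360 - (instanceAngle j - instanceAngle i))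
      ?_ (by linarith) (Or.inr (by ring)) ?_
    all_goals
      revert h hij
      fin_cases i <;> fin_cases j <;> norm_num [instanceAngle, chordBound]

lemma chordBound_le_dist {i j : Fin 7} (hij : i ≠ j) :
    (chordBound i j : ℝ) ≤
      100 * dist (unitCirclePtDeg (instanceAngle i)) (unitCirclePtDeg (instanceAngle j)) := by
  rcases hij.lt_or_gt with h | h
  · exact chordBound_le_dist_of_lt h
  · rw [chordBound_symm, dist_comm]
    exact chordBound_le_dist_of_lt h

lemma unitCirclePtDeg_instanceAngle_injective :
    Function.Injective fun i => unitCirclePtDeg (instanceAngle i) := by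
  intro i j hij
  by_contra hne
  have h := chordBound_le_dist hne
  rw [dist_eq_zero.2 hij, mul_zero] at h
  exact (chordBound_pos hne).ne' (by exact_mod_cast h.antisymm (Nat.cast_nonneg _))

/-- Exhaustive search over binary trees: `infeasible d B n active rest` certifies, within
recursion depth `n`, that no tree with edge lengths at least `d` extends the current forest
while reaching every node before time `B`. The list `active` holds the nodes whose children are
still to be chosen, with lower bounds for their times, and `rest` the nodes not yet reached. -/
def infeasible {α : Type*} [DecidableEq α] (d : α → α → ℕ) (B : ℕ) :
    ℕ → List (α × ℕ) → List α → Bool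
  | 0, _, _ => false
  | _ + 1, [], rest => !rest.isEmpty
  | n + 1, (u, T) :: active, rest =>
    (rest.filter fun x => decide (T + d u x < B)).sublists.all fun C =>
      decide (2 < C.length) ||
        infeasible d B n (C.map (fun x => (x, T + d u x)) ++ active)
          (rest.filter fun x => decide (x ∉ C))

/-- Soundness of the search: a tree with parent function `q` and times `t` below `B` rules out
a successful run of `infeasible`. -/
lemma not_infeasible {α : Type*} [DecidableEq α] {d : α → α → ℕ} {B : ℕ} {c : α} {q : α → α}
    {t : α → ℝ} (hd : ∀ x y, x ≠ y → 0 < d x y) (hq : ∀ x, x ≠ c → q x ≠ x)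
    (ht : ∀ x, x ≠ c → t (q x) + d (q x) x ≤ t x) (hB : ∀ x, t x < B)
    (htwo : ∀ x y z, x ≠ c → y ≠ c → z ≠ c → q y = q x → q z = q x → x = y ∨ x = z ∨ y = z)
    {n : ℕ} {active : List (α × ℕ)} {rest : List α} (hrun : infeasible d B n active rest = true)
    (hrest : rest.Nodup ∧ c ∉ rest) (hactive : ∀ p ∈ active, (p.2 : ℝ) ≤ t p.1)
    (hparent : ∀ x ∈ rest, q x ∈ rest ∨ q x ∈ active.map Prod.fst) : False := by
  have hne : ∀ {l : List α}, c ∉ l → ∀ {x}, x ∈ l → x ≠ c := by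
    rintro l hl x hx rfl
    exact hl hx
  induction n generalizing active rest with
  | zero => simp [infeasible] at hrun
  | succ n ih =>
    match active with
    | [] =>
      have hnil : rest ≠ [] := by simpa [infeasible] using hrun
      obtain ⟨x, hx, hmin⟩ := rest.toFinset.exists_min_image t (by simpa using hnil)
      rw [List.mem_toFinset] at hx
      have hqx : q x ∈ rest := by simpa using hparent x hx
      have hxc := hne hrest.2 hx
      have hpos : (0 : ℝ) < d (q x) x := by exact_mod_cast hd _ _ (hq x hxc)
      linarith [ht x hxc, hmin _ (List.mem_toFinset.2 hqx)]
    | (u, T) :: active =>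
      have huT : (T : ℝ) ≤ t u := hactive (u, T) (by simp)
      have hchild : ∀ x ∈ rest, q x = u → ((T + d u x : ℕ) : ℝ) ≤ t x := by
        rintro x hx rfl
        push_cast
        linarith [ht x (hne hrest.2 hx)]
      set C := rest.filter fun x => decide (q x = u) with hC
      have hmemC : ∀ {x}, x ∈ C ↔ x ∈ rest ∧ q x = u := by simp [hC]
      have hsub : C ∈ (rest.filter fun x => decide (T + d u x < B)).sublists := by
        have hCf : C = (rest.filter fun x => decide (T + d u x < B)).filter
            fun x => decide (q x = u) := by
          rw [hC, List.filter_filter]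
          refine List.filter_congr fun x hx => ?_
          rw [Bool.eq_iff_iff]
          simp only [Bool.and_eq_true, decide_eq_true_eq]
          exact ⟨fun h => ⟨h, by exact_mod_cast (hchild x hx h).trans_lt (hB x)⟩, fun h => h.1⟩
        rw [List.mem_sublists, hCf]
        exact List.filter_sublist
      have hlen : C.length ≤ 2 := by
        by_contra! hlen
        have hnd : C.Nodup := hrest.1.filter _
        match hCe : C, hlen with
        | x :: y :: z :: l, _ =>
          obtain ⟨hx, hxu⟩ := hmemC (x := x).1 (by simp)
          obtain ⟨hy, hyu⟩ := hmemC (x := y).1 (by simp)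
          obtain ⟨hz, hzu⟩ := hmemC (x := z).1 (by simp)
          have := htwo x y z (hne hrest.2 hx) (hne hrest.2 hy) (hne hrest.2 hz)
            (hyu.trans hxu.symm) (hzu.trans hxu.symm)
          simp at hnd
          tauto
      have hstep := List.all_eq_true.1 hrun C hsub
      rw [Bool.or_eq_true, decide_eq_true_iff, or_iff_right (by omega)] at hstep
      refine ih hstep ⟨hrest.1.filter _, fun h => hrest.2 (List.mem_of_mem_filter h)⟩ ?_ ?_
      · intro p hp
        rcases List.mem_append.1 hp with h | h
        · obtain ⟨x, hx, rfl⟩ := List.mem_map.1 h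
          exact hchild x (hmemC.1 hx).1 (hmemC.1 hx).2
        · exact hactive p (by simp [h])
      · intro x hx
        simp only [List.mem_filter, decide_eq_true_eq] at hx
        have hxu : q x ≠ u := fun h => hx.2 (hmemC.2 ⟨hx.1, h⟩)
        have h := hparent x hx.1
        simp only [List.map_cons, List.mem_cons, hxu, false_or] at h
        simp only [List.map_append, List.map_map, List.mem_append, List.mem_filter,
          decide_eq_true_eq]
        by_cases hqC : q x ∈ C
        · exact Or.inr (Or.inl (List.mem_map.2 ⟨q x, hqC, rfl⟩))
        · tauto

lemma infeasible_chordBound (c : Fin 7) :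
    infeasible chordBound 349 8 [(c, 100)] ((List.finRange 7).filter fun x => decide (x ≠ c)) =
      true := by
  decide +kernel +revert

/-- every wake-up tree rooted at the origin for the seven-point instance
with polar angles `31.52°, 101.98°, 148.90°, 195.69°, 225.69°, 271.63°, 327.87°` on the
unit circle has makespan at least `3.49`. -/
theorem sevenPointInstance_makespan_ge
    (parent : EuclideanSpace ℝ (Fin 2) → EuclideanSpace ℝ (Fin 2))
    (t : EuclideanSpace ℝ (Fin 2) → ℝ)
    (h : IsWakeUpTree dist (0 : EuclideanSpace ℝ (Fin 2)) sevenPointInstance parent t) :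
    ∃ p, (p = (0 : EuclideanSpace ℝ (Fin 2)) ∨ p ∈ sevenPointInstance) ∧ 3.49 ≤ t p := by
  by_contra! hlt
  obtain ⟨t_zero, htree, hroot, hexists, htwo⟩ := h
  have hmem : ∀ i, unitCirclePtDeg (instanceAngle i) ∈ sevenPointInstance := fun i =>
    mem_sevenPointInstance.2 ⟨i, rfl⟩
  have hne : ∀ i, unitCirclePtDeg (instanceAngle i) ≠ 0 := fun i => unitCirclePtDeg_ne_zero _
  obtain ⟨_, hcS, -, hc⟩ := hexists ⟨_, hmem 0, hne 0⟩
  obtain ⟨c, rfl⟩ := mem_sevenPointInstance.1 hcS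
  have hpar : ∀ i, ∃ j, i ≠ c →
      parent (unitCirclePtDeg (instanceAngle i)) = unitCirclePtDeg (instanceAngle j) := by
    intro i
    by_cases hi : i = c
    · exact ⟨i, fun h => absurd hi h⟩
    rcases (htree _ (hmem i) (hne i)).1 with h0 | hS
    · exact absurd (unitCirclePtDeg_instanceAngle_injective
        (hroot _ (hmem i) (hne i) h0 _ hcS (hne c) hc)) hi
    · obtain ⟨j, hj⟩ := mem_sevenPointInstance.1 hS
      exact ⟨j, fun _ => hj.symm⟩
  choose q hq using hpar
  have hqne : ∀ i, i ≠ c → q i ≠ i := by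
    intro i hi hqi
    obtain ⟨n, hn⟩ := (htree _ (hmem i) (hne i)).2.2
    have hfix : parent (unitCirclePtDeg (instanceAngle i)) =
        unitCirclePtDeg (instanceAngle i) := by rw [hq i hi, hqi]
    rw [Function.iterate_fixed hfix] at hn
    exact hne i hn
  have hct : t (unitCirclePtDeg (instanceAngle c)) = 1 := by
    have h := (htree _ hcS (hne c)).2.1
    rw [hc, t_zero, dist_zero_left, norm_unitCirclePtDeg] at h
    linarith
  refine not_infeasible (d := chordBound) (B := 349) (c := c) (q := q)
    (t := fun i => 100 * t (unitCirclePtDeg (instanceAngle i)))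
    (fun i j hij => chordBound_pos hij) hqne ?_ ?_ ?_
    (infeasible_chordBound c) ?_ ?_ ?_
  · intro i hi
    have h := (htree _ (hmem i) (hne i)).2.1
    rw [hq i hi] at h
    have := chordBound_le_dist (hqne i hi)
    linarith
  · intro i
    have := hlt _ (Or.inr (hmem i))
    push_cast
    linarith
  · intro x y z hx hy hz hxy hxz
    have h := htwo _ (hmem (q x)) (hne _) _ (hmem x) _ (hmem y) _ (hmem z) (hne _) (hne _) (hne _)
      (hq x hx) (by rw [hq y hy, hxy]) (by rw [hq z hz, hxz])
    simpa only [unitCirclePtDeg_instanceAngle_injective.eq_iff] using h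
  · exact ⟨(List.nodup_finRange 7).filter _, by simp⟩
  · simp [hct]
  · intro x hx
    by_cases h : q x = c <;> simp [h]
end
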